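/- Let X₁ and X₂ be normed vector spaces over ℝ or ℂ and T₁ : X₁ → X₁, T₂ : X₂ → X₂ bounded chain transitive linear operators. Then the product operator T₁ × T₂ : X₁ × X₂ → X₁ × X₂, (x, y) ↦ (T₁ x, T₂ y), on the product space endowed with the sup norm ‖(x, y)‖ = max(‖x‖, ‖y‖), is chain transitive. -/

import Mathlib

/-- An `ε`-chain of `T` from `x` to `y`: a finite sequence `x = c 0, c 1, …, c n = y`
with `n ≥ 1` such that `‖T (c i) - c (i+1)‖ < ε` for every `0 ≤ i < n`. -/
def EpsChain {E : Type*} [NormedAddCommGroup E] (T : E → E) (ε : ℝ) (x y : E) : Prop :=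
  ∃ (n : ℕ) (c : ℕ → E), 1 ≤ n ∧ c 0 = x ∧ c n = y ∧ ∀ i < n, ‖T (c i) - c (i + 1)‖ < ε

/-- `x` is a chain recurrent point of `T` if for every `ε > 0` there is an `ε`-chain
beginning and ending at `x`. -/
def ChainRecurrent {E : Type*} [NormedAddCommGroup E] (T : E → E) (x : E) : Prop :=
  ∀ ε > 0, EpsChain T ε x x

/-- An `ε`-chain from `x` to itself extends to an infinite periodic sequence of `ε`-steps. -/
theorem EpsChain.exists_periodic {E : Type*} [NormedAddCommGroup E] {T : E → E} {ε : ℝ} {x : E}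
    (h : EpsChain T ε x x) :
    ∃ (n : ℕ) (c : ℕ → E), 1 ≤ n ∧ (∀ k, c (n * k) = x) ∧ ∀ i, ‖T (c i) - c (i + 1)‖ < ε := by
  obtain ⟨n, c, hn, h0, hcn, hc⟩ := h
  refine ⟨n, fun i => c (i % n), hn, fun k => by simp [h0], fun i => ?_⟩
  have hi : i % n < n := Nat.mod_lt _ hn
  have hstep : c ((i + 1) % n) = c (i % n + 1) := by
    rw [← Nat.mod_add_mod]
    rcases Nat.lt_or_eq_of_le (Nat.succ_le_of_lt hi) with hlt | heq
    · rw [Nat.mod_eq_of_lt hlt]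
    · rw [Nat.succ_eq_add_one] at heq
      rw [heq, Nat.mod_self, h0, hcn]
  simpa only [hstep] using hc _ hi

/-- The product of two bounded chain transitive operators, on the product space with the
sup norm `‖(x, y)‖ = max ‖x‖ ‖y‖` (which is the norm on `X₁ × X₂` in Mathlib), is chain
transitive. -/
theorem stmt_13 {𝕜 : Type*} [RCLike 𝕜] {X₁ : Type*} [NormedAddCommGroup X₁]
    [NormedSpace 𝕜 X₁] {X₂ : Type*} [NormedAddCommGroup X₂] [NormedSpace 𝕜 X₂]
    (T₁ : X₁ →L[𝕜] X₁) (T₂ : X₂ →L[𝕜] X₂)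
    (h₁ : ∀ x : X₁, ChainRecurrent (⇑T₁) x) (h₂ : ∀ y : X₂, ChainRecurrent (⇑T₂) y) :
    ∀ p : X₁ × X₂, ChainRecurrent (fun q : X₁ × X₂ => (T₁ q.1, T₂ q.2)) p := by
  intro p ε hε
  obtain ⟨n, c, hn, hcx, hc⟩ := (h₁ p.1 ε hε).exists_periodic
  obtain ⟨m, d, hm, hdy, hd⟩ := (h₂ p.2 ε hε).exists_periodic
  refine ⟨n * m, fun i => (c i, d i), Nat.mul_pos hn hm, ?_, ?_, fun i _ => ?_⟩
  · exact Prod.ext (hcx 0) (hdy 0)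
  · exact Prod.ext (hcx m) (by simpa only [mul_comm] using hdy n)
  · exact max_lt (hc i) (hd i)
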